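/- Let A be a finite idempotent algebra omitting type 1 all of whose edges have the affine type. Then A is Mal'tsev: some term operation m of A satisfies m(x,y,y)=m(y,y,x)=x for all x,y in A. -/

import Mathlib

/-! Common framework: universal algebras over a fixed signature, terms,
subalgebras, congruences, quotients, edges and their types (Bulatov's
coloured-graph approach), thin edges, connectivity, products, etc. -/

/-- A (functional) signature: a type of operation symbols with arities. -/
structure Signature where
  ops : Type
  arity : ops → ℕ

/-- An algebra of a given signature. -/
structure UAlgebra (σ : Signature) where
  carrier : Type
  interp : ∀ f : σ.ops, (Fin (σ.arity f) → carrier) → carrier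

/-- Terms over the signature `σ` in `n` variables. -/
inductive Term (σ : Signature) (n : ℕ) where
  | var : Fin n → Term σ n
  | app : (f : σ.ops) → (Fin (σ.arity f) → Term σ n) → Term σ n

/-- Evaluation of a term in an algebra; term operations of an algebra are
exactly the operations of the form `Term.eval A t`. -/
def Term.eval {σ : Signature} {n : ℕ} (A : UAlgebra σ) :
    Term σ n → (Fin n → A.carrier) → A.carrier
  | .var i, x => x i
  | .app f ts, x => A.interp f fun j => Term.eval A (ts j) x

namespace UAlgebra

variable {σ : Signature}

/-- An algebra is idempotent if all its basic operations are. -/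
def Idempotent (A : UAlgebra σ) : Prop :=
  ∀ (f : σ.ops) (a : A.carrier), A.interp f (fun _ => a) = a

/-- A set closed under all basic operations. -/
def IsClosed (A : UAlgebra σ) (S : Set A.carrier) : Prop :=
  ∀ (f : σ.ops) (x : Fin (σ.arity f) → A.carrier), (∀ j, x j ∈ S) → A.interp f x ∈ S

/-- Closure of a set under the basic operations. -/
inductive Closure (A : UAlgebra σ) (S : Set A.carrier) : A.carrier → Prop
  | base {a : A.carrier} : a ∈ S → Closure A S a
  | app (f : σ.ops) (x : Fin (σ.arity f) → A.carrier) :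
      (∀ j, Closure A S (x j)) → Closure A S (A.interp f x)

def ClosureSet (A : UAlgebra σ) (S : Set A.carrier) : Set A.carrier := {x | Closure A S x}

theorem closureSet_isClosed (A : UAlgebra σ) (S : Set A.carrier) :
    A.IsClosed (A.ClosureSet S) := fun f x h => Closure.app f x h

/-- The subalgebra of `A` on a closed subset `S`. -/
def subalg (A : UAlgebra σ) (S : Set A.carrier) (hS : A.IsClosed S) : UAlgebra σ where
  carrier := {x : A.carrier // x ∈ S}
  interp f x := ⟨A.interp f fun j => (x j : A.carrier), hS f _ fun j => (x j).2⟩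

/-- The subalgebra generated by a set `S`. -/
def Sg (A : UAlgebra σ) (S : Set A.carrier) : UAlgebra σ :=
  A.subalg (A.ClosureSet S) (A.closureSet_isClosed S)

/-- `a` as an element of `Sg {a, b}`. -/
def sgA (A : UAlgebra σ) (a b : A.carrier) : (A.Sg {a, b}).carrier :=
  ⟨a, Closure.base (Set.mem_insert a {b})⟩

/-- `b` as an element of `Sg {a, b}`. -/
def sgB (A : UAlgebra σ) (a b : A.carrier) : (A.Sg {a, b}).carrier :=
  ⟨b, Closure.base (Set.mem_insert_iff.mpr (Or.inr rfl))⟩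

/-- A congruence of an algebra. -/
structure Congruence (A : UAlgebra σ) where
  rel : A.carrier → A.carrier → Prop
  refl : ∀ x, rel x x
  symm : ∀ {x y}, rel x y → rel y x
  trans : ∀ {x y z}, rel x y → rel y z → rel x z
  compat : ∀ (f : σ.ops) (x y : Fin (σ.arity f) → A.carrier),
      (∀ j, rel (x j) (y j)) → rel (A.interp f x) (A.interp f y)

def Congruence.toSetoid {A : UAlgebra σ} (θ : Congruence A) : Setoid A.carrier :=
  ⟨θ.rel, ⟨θ.refl, θ.symm, θ.trans⟩⟩

/-- The full congruence. -/
def Congruence.IsFull {A : UAlgebra σ} (θ : Congruence A) : Prop := ∀ x y, θ.rel x y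

def Congruence.le {A : UAlgebra σ} (θ η : Congruence A) : Prop :=
  ∀ x y, θ.rel x y → η.rel x y

/-- A maximal congruence: proper, and any congruence above it is full or below it. -/
def Congruence.IsMaximal {A : UAlgebra σ} (θ : Congruence A) : Prop :=
  ¬ θ.IsFull ∧ ∀ η : Congruence A, θ.le η → ¬ η.IsFull → η.le θ

/-- The quotient (factor) algebra. -/
noncomputable def quot (A : UAlgebra σ) (θ : Congruence A) : UAlgebra σ where
  carrier := Quotient θ.toSetoid
  interp f x := Quotient.mk θ.toSetoid (A.interp f fun j => (x j).out)

/-- The class of `a` in the quotient of `Sg {a,b}` by `θ`. -/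
def qa (A : UAlgebra σ) (a b : A.carrier) (θ : Congruence (A.Sg {a, b})) :
    ((A.Sg {a, b}).quot θ).carrier :=
  Quotient.mk θ.toSetoid (A.sgA a b)

def qb (A : UAlgebra σ) (a b : A.carrier) (θ : Congruence (A.Sg {a, b})) :
    ((A.Sg {a, b}).quot θ).carrier :=
  Quotient.mk θ.toSetoid (A.sgB a b)

end UAlgebra

/-- A binary operation is a semilattice operation on a set `B`. -/
def IsSemilatticeOn {α : Type} (f : α → α → α) (B : Set α) : Prop :=
  (∀ x ∈ B, f x x = x) ∧ (∀ x ∈ B, ∀ y ∈ B, f x y = f y x) ∧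
    (∀ x ∈ B, ∀ y ∈ B, ∀ z ∈ B, f x (f y z) = f (f x y) z)

/-- A ternary operation is a majority operation on a set `B`. -/
def IsMajorityOn {α : Type} (g : α → α → α → α) (B : Set α) : Prop :=
  ∀ x ∈ B, ∀ y ∈ B, g x x y = x ∧ g x y x = x ∧ g y x x = x

/-- A ternary operation is a Mal'tsev operation on a set `B`. -/
def IsMaltsevOn {α : Type} (h : α → α → α → α) (B : Set α) : Prop :=
  ∀ x ∈ B, ∀ y ∈ B, h x y y = x ∧ h y y x = x

namespace UAlgebra

variable {σ : Signature}

/-- An algebra is "a set": every term operation is a projection. -/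
def IsSetAlgebra (Q : UAlgebra σ) : Prop :=
  ∀ (n : ℕ) (t : Term σ n), ∃ i : Fin n, ∀ x : Fin n → Q.carrier, t.eval Q x = x i

/-- An algebra is the full idempotent reduct of a module over some finite ring:
its term operations are exactly the idempotent affine combinations; in
particular the affine operation `x - y + z` is a term operation. -/
def IsAffineAlgebra (Q : UAlgebra σ) : Prop :=
  ∃ (R : Type) (_ : Ring R) (_ : Finite R) (_ : AddCommGroup Q.carrier)
    (_ : Module R Q.carrier),
    (∀ (n : ℕ) (g : (Fin n → Q.carrier) → Q.carrier),
      (∃ t : Term σ n, ∀ x, t.eval Q x = g x) ↔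
      (∃ c : Fin n → R, (∑ i, c i) = 1 ∧ ∀ x, g x = ∑ i, c i • x i)) ∧
    (∃ t : Term σ 3, ∀ x y z : Q.carrier, t.eval Q ![x, y, z] = x - y + z)

/-- `θ` witnesses that `ab` is an edge of the unary type. -/
def UnaryWitness (A : UAlgebra σ) (a b : A.carrier) (θ : Congruence (A.Sg {a, b})) : Prop :=
  θ.IsMaximal ∧ IsSetAlgebra ((A.Sg {a, b}).quot θ)

/-- `θ` witnesses that `ab` is an edge of the semilattice type. -/
def SLWitness (A : UAlgebra σ) (a b : A.carrier) (θ : Congruence (A.Sg {a, b})) : Prop :=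
  θ.IsMaximal ∧ ∃ t : Term σ 2,
    IsSemilatticeOn (fun x y => t.eval ((A.Sg {a, b}).quot θ) ![x, y])
      {A.qa a b θ, A.qb a b θ}

/-- `θ` witnesses that `ab` is an edge of the majority type. -/
def MajWitness (A : UAlgebra σ) (a b : A.carrier) (θ : Congruence (A.Sg {a, b})) : Prop :=
  θ.IsMaximal ∧
  (∃ t : Term σ 3,
    IsMajorityOn (fun x y z => t.eval ((A.Sg {a, b}).quot θ) ![x, y, z])
      {A.qa a b θ, A.qb a b θ}) ∧
  ¬ (∃ t : Term σ 2,
    IsSemilatticeOn (fun x y => t.eval ((A.Sg {a, b}).quot θ) ![x, y])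
      {A.qa a b θ, A.qb a b θ})

/-- `θ` witnesses that `ab` is an edge of the affine type. -/
def AffWitness (A : UAlgebra σ) (a b : A.carrier) (θ : Congruence (A.Sg {a, b})) : Prop :=
  θ.IsMaximal ∧ IsAffineAlgebra ((A.Sg {a, b}).quot θ)

/-- A pair of distinct elements is an edge. -/
def IsEdge (A : UAlgebra σ) (a b : A.carrier) : Prop :=
  a ≠ b ∧ ∃ θ : Congruence (A.Sg {a, b}), ¬ θ.IsFull ∧
    (IsSetAlgebra ((A.Sg {a, b}).quot θ) ∨
     IsAffineAlgebra ((A.Sg {a, b}).quot θ) ∨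
     (∃ t : Term σ 2,
        IsSemilatticeOn (fun x y => t.eval ((A.Sg {a, b}).quot θ) ![x, y])
          {A.qa a b θ, A.qb a b θ}) ∨
     (∃ t : Term σ 3,
        IsMajorityOn (fun x y z => t.eval ((A.Sg {a, b}).quot θ) ![x, y, z])
          {A.qa a b θ, A.qb a b θ}))

def IsUnaryEdge (A : UAlgebra σ) (a b : A.carrier) : Prop :=
  a ≠ b ∧ ∃ θ : Congruence (A.Sg {a, b}), UnaryWitness A a b θ

def IsSLEdge (A : UAlgebra σ) (a b : A.carrier) : Prop :=
  a ≠ b ∧ ∃ θ : Congruence (A.Sg {a, b}), SLWitness A a b θ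

def IsMajEdge (A : UAlgebra σ) (a b : A.carrier) : Prop :=
  a ≠ b ∧ ∃ θ : Congruence (A.Sg {a, b}), MajWitness A a b θ

def IsAffEdge (A : UAlgebra σ) (a b : A.carrier) : Prop :=
  a ≠ b ∧ ∃ θ : Congruence (A.Sg {a, b}), AffWitness A a b θ

end UAlgebra

/-- The four types of edges. -/
inductive EdgeType where
  | unary | semilattice | majority | affine
deriving DecidableEq

namespace UAlgebra

variable {σ : Signature}

def HasEdgeOfType (A : UAlgebra σ) (τ : EdgeType) (a b : A.carrier) : Prop :=
  match τ with
  | .unary => A.IsUnaryEdge a b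
  | .semilattice => A.IsSLEdge a b
  | .majority => A.IsMajEdge a b
  | .affine => A.IsAffEdge a b

/-- `T`-restricted algebra: every edge has a type from `T`. -/
def Restricted (A : UAlgebra σ) (T : Set EdgeType) : Prop :=
  ∀ a b : A.carrier, A.IsEdge a b → ∃ τ ∈ T, A.HasEdgeOfType τ a b

/-- `A` omits type 1: no subalgebra of `A` has an edge of the unary type. -/
def OmitsType1 (A : UAlgebra σ) : Prop :=
  ∀ (S : Set A.carrier) (hS : A.IsClosed S) (a b : (A.subalg S hS).carrier),
    ¬ (A.subalg S hS).IsUnaryEdge a b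

/-- The union of the two `θ`-blocks of a thick edge, as a subset of `A`. -/
def edgeBlockUnion (A : UAlgebra σ) (a b : A.carrier) (θ : Congruence (A.Sg {a, b})) :
    Set A.carrier :=
  {x | ∃ hx : x ∈ A.ClosureSet {a, b},
    θ.rel ⟨x, hx⟩ (A.sgA a b) ∨ θ.rel ⟨x, hx⟩ (A.sgB a b)}

/-- Smooth algebra: for every semilattice- or majority-type edge with a witnessing
maximal congruence, the union of the two blocks is a subuniverse. -/
def IsSmooth (A : UAlgebra σ) : Prop :=
  ∀ (a b : A.carrier) (θ : Congruence (A.Sg {a, b})),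
    (SLWitness A a b θ ∨ MajWitness A a b θ) → A.IsClosed (A.edgeBlockUnion a b θ)

def SemilatticeFree (A : UAlgebra σ) : Prop := ∀ a b : A.carrier, ¬ A.IsSLEdge a b
def MajorityFree (A : UAlgebra σ) : Prop := ∀ a b : A.carrier, ¬ A.IsMajEdge a b
def AffineFree (A : UAlgebra σ) : Prop := ∀ a b : A.carrier, ¬ A.IsAffEdge a b

/-- Thin semilattice edge. -/
def IsThinSLEdge (A : UAlgebra σ) (a b : A.carrier) : Prop :=
  ∃ t : Term σ 2, t.eval A ![a, a] = a ∧ t.eval A ![a, b] = b ∧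
    t.eval A ![b, a] = b ∧ t.eval A ![b, b] = b

/-- Undirected thin majority edge: some term operation is majority on `{a, b}`. -/
def IsUndirThinMajEdge (A : UAlgebra σ) (a b : A.carrier) : Prop :=
  ∃ t : Term σ 3, IsMajorityOn (fun x y z => t.eval A ![x, y, z]) {a, b}

/-- Mal'tsev edge: some term operation is Mal'tsev on `{a, b}`. -/
def IsMaltsevEdge (A : UAlgebra σ) (a b : A.carrier) : Prop :=
  ∃ t : Term σ 3, IsMaltsevOn (fun x y z => t.eval A ![x, y, z]) {a, b}

/-- The class of all quotients of subalgebras of `A`. -/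
def QuotSub (A : UAlgebra σ) : Set (UAlgebra σ) :=
  {B | ∃ (S : Set A.carrier) (hS : A.IsClosed S)
        (θ : Congruence (A.subalg S hS)), B = (A.subalg S hS).quot θ}

end UAlgebra

/-- The class of all quotients of subalgebras of the algebras of a class. -/
def QuotSubClass {σ : Signature} (K : Set (UAlgebra σ)) : Set (UAlgebra σ) :=
  {B | ∃ A ∈ K, B ∈ UAlgebra.QuotSub A}

/-- A ternary term satisfies the majority condition relative to a class `𝒦`. -/
def MajorityCondition {σ : Signature} (𝒦 : Set (UAlgebra σ)) (t : Term σ 3) : Prop :=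
  (∀ B ∈ 𝒦, ∀ x y : B.carrier,
    t.eval B ![x, t.eval B ![x, y, y], t.eval B ![x, y, y]] = t.eval B ![x, y, y]) ∧
  (∀ B ∈ 𝒦, ∀ (a b : B.carrier) (θ : UAlgebra.Congruence (B.Sg {a, b})),
    a ≠ b → UAlgebra.MajWitness B a b θ →
    IsMajorityOn (fun x y z => t.eval ((B.Sg {a, b}).quot θ) ![x, y, z])
      {B.qa a b θ, B.qb a b θ})

/-- A ternary term satisfies the minority condition relative to a class `𝒦`. -/
def MinorityCondition {σ : Signature} (𝒦 : Set (UAlgebra σ)) (t : Term σ 3) : Prop :=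
  (∀ B ∈ 𝒦, ∀ x y : B.carrier,
    t.eval B ![t.eval B ![x, y, y], y, y] = t.eval B ![x, y, y]) ∧
  (∀ B ∈ 𝒦, ∀ (a b : B.carrier) (θ : UAlgebra.Congruence (B.Sg {a, b})),
    a ≠ b → UAlgebra.AffWitness B a b θ →
    IsMaltsevOn (fun x y z => t.eval ((B.Sg {a, b}).quot θ) ![x, y, z])
      {B.qa a b θ, B.qb a b θ})

/-- Thin majority edge relative to a class `𝒦`. -/
def IsThinMajEdge {σ : Signature} (𝒦 : Set (UAlgebra σ)) (A : UAlgebra σ)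
    (a b : A.carrier) : Prop :=
  ∀ t : Term σ 3, MajorityCondition 𝒦 t →
    b ∈ A.ClosureSet {a, t.eval A ![a, b, b]} ∧
    b ∈ A.ClosureSet {a, t.eval A ![b, a, b]} ∧
    b ∈ A.ClosureSet {a, t.eval A ![b, b, a]}

/-- Thin affine edge relative to a class `𝒦` (with respect to some fixed term
operation satisfying the minority condition). -/
def IsThinAffEdge {σ : Signature} (𝒦 : Set (UAlgebra σ)) (A : UAlgebra σ)
    (a b : A.carrier) : Prop :=
  (∃ t : Term σ 3, MinorityCondition 𝒦 t ∧ t.eval A ![b, a, a] = b) ∧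
  ∀ t : Term σ 3, MinorityCondition 𝒦 t → b ∈ A.ClosureSet {a, t.eval A ![a, a, b]}

namespace UAlgebra

variable {σ : Signature}

/-- Reachability in the digraph `Gs(A)` of thin semilattice edges. -/
def sReach (A : UAlgebra σ) : A.carrier → A.carrier → Prop :=
  Relation.ReflTransGen (fun x y => A.IsThinSLEdge x y)

/-- A maximal element of `Gs(A)`: an element of a maximal strongly connected
component. -/
def IsMaxElem (A : UAlgebra σ) (a : A.carrier) : Prop :=
  ∀ b, A.sReach a b → A.sReach b a

/-- A maximal component of `Gs(A)`: the strongly connected component of a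
maximal element. -/
def IsMaxComponent (A : UAlgebra σ) (C : Set A.carrier) : Prop :=
  ∃ a, A.IsMaxElem a ∧ C = {b | A.sReach a b ∧ A.sReach b a}

end UAlgebra

/-- An arc of the digraph `Gas(A)`: a thin semilattice or thin affine edge. -/
def asStep {σ : Signature} (𝒦 : Set (UAlgebra σ)) (A : UAlgebra σ)
    (x y : A.carrier) : Prop :=
  A.IsThinSLEdge x y ∨ IsThinAffEdge 𝒦 A x y

/-- Reachability in `Gas(A)`. -/
def asReach {σ : Signature} (𝒦 : Set (UAlgebra σ)) (A : UAlgebra σ) :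
    A.carrier → A.carrier → Prop :=
  Relation.ReflTransGen (asStep 𝒦 A)

/-- An as-maximal element: an element of an as-component. -/
def IsAsMaxElem {σ : Signature} (𝒦 : Set (UAlgebra σ)) (A : UAlgebra σ)
    (a : A.carrier) : Prop :=
  ∀ b, asReach 𝒦 A a b → asReach 𝒦 A b a

/-- An as-component of `A`: a maximal strongly connected component of `Gas(A)`. -/
def IsAsComponent {σ : Signature} (𝒦 : Set (UAlgebra σ)) (A : UAlgebra σ)
    (C : Set A.carrier) : Prop :=
  ∃ a, IsAsMaxElem 𝒦 A a ∧ C = {b | asReach 𝒦 A a b ∧ asReach 𝒦 A b a}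

namespace UAlgebra

variable {σ : Signature}

/-- Binary direct product. -/
def prod (A B : UAlgebra σ) : UAlgebra σ where
  carrier := A.carrier × B.carrier
  interp f x := (A.interp f fun j => (x j).1, B.interp f fun j => (x j).2)

/-- Direct product of a family. -/
def pi {ι : Type} (A : ι → UAlgebra σ) : UAlgebra σ where
  carrier := ∀ i, (A i).carrier
  interp f x := fun i => (A i).interp f fun j => x j i

/-- Homomorphism of similar algebras. -/
def IsHom (A B : UAlgebra σ) (φ : A.carrier → B.carrier) : Prop :=
  ∀ (f : σ.ops) (x : Fin (σ.arity f) → A.carrier),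
    φ (A.interp f x) = B.interp f fun j => φ (x j)

/-- Simple algebra: only the equality and full congruences. -/
def IsSimple (A : UAlgebra σ) : Prop :=
  ∀ θ : Congruence A, (∀ x y, θ.rel x y ↔ x = y) ∨ θ.IsFull

/-- Maximal generated algebra: generated by one of its maximal components. -/
def MaximalGenerated (A : UAlgebra σ) : Prop :=
  ∃ C : Set A.carrier, A.IsMaxComponent C ∧ A.ClosureSet C = Set.univ

/-- The number of subalgebras (nonempty closed subsets) of an algebra. -/
noncomputable def numSubalgebras (A : UAlgebra σ) : ℕ :=
  Nat.card {S : Set A.carrier // S.Nonempty ∧ A.IsClosed S}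

end UAlgebra

/-- A (k+3)-ary term is an edge term for a class `𝒦`. -/
def IsEdgeTermFor {σ : Signature} (𝒦 : Set (UAlgebra σ)) {k : ℕ}
    (t : Term σ (k + 3)) : Prop :=
  ∀ A ∈ 𝒦, ∀ x y : A.carrier,
    t.eval A (fun i => if i.val ≤ 1 then y else x) = x ∧
    t.eval A (fun i => if i.val = 0 ∨ i.val = 2 then y else x) = x ∧
    ∀ j : Fin (k + 3), 3 ≤ j.val →
      t.eval A (Function.update (fun _ => x) j y) = x

/-- A finite class has few subproducts. -/
def FewSubproducts {σ : Signature} (K : Set (UAlgebra σ)) : Prop :=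
  ∃ p : Polynomial ℕ, ∀ (n : ℕ) (A : Fin n → UAlgebra σ), (∀ i, A i ∈ K) →
    UAlgebra.numSubalgebras (UAlgebra.pi A) ≤ 2 ^ (p.eval n)

/-- `g_K` is bounded by a polynomial: every subalgebra of an `n`-fold product
of members of `K` has a generating set of polynomial size. -/
def PolyGenerated {σ : Signature} (K : Set (UAlgebra σ)) : Prop :=
  ∃ p : Polynomial ℕ, ∀ (n : ℕ) (A : Fin n → UAlgebra σ), (∀ i, A i ∈ K) →
    ∀ S : Set (UAlgebra.pi A).carrier, S.Nonempty → (UAlgebra.pi A).IsClosed S →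
      ∃ G : Set (UAlgebra.pi A).carrier, G ⊆ S ∧ G.Finite ∧
        G.ncard ≤ p.eval n ∧ (UAlgebra.pi A).ClosureSet G = S

namespace Term

variable {σ : Signature} {n k : ℕ}

/-- Simultaneous substitution of terms for the variables of a term. -/
def subst : Term σ n → (Fin n → Term σ k) → Term σ k
  | .var i, s => s i
  | .app f ts, s => .app f fun j => (ts j).subst s

variable (A : UAlgebra σ)

theorem eval_var (i : Fin n) (x : Fin n → A.carrier) : (var i : Term σ n).eval A x = x i := rfl

theorem eval_subst (t : Term σ n) (s : Fin n → Term σ k) (x : Fin k → A.carrier) :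
    (t.subst s).eval A x = t.eval A fun i => (s i).eval A x := by
  induction t with
  | var i => rfl
  | app f ts ih =>
    simp only [subst, eval]
    congr 1
    funext j
    exact ih j

theorem eval_subst₂ (t : Term σ 2) (p q : Term σ k) (x : Fin k → A.carrier) :
    (t.subst ![p, q]).eval A x = t.eval A ![p.eval A x, q.eval A x] := by
  rw [eval_subst]
  congr 1
  funext i
  fin_cases i <;> rfl

theorem eval_subst₃ (t : Term σ 3) (p q r : Term σ k) (x : Fin k → A.carrier) :
    (t.subst ![p, q, r]).eval A x = t.eval A ![p.eval A x, q.eval A x, r.eval A x] := by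
  rw [eval_subst]
  congr 1
  funext i
  fin_cases i <;> rfl

/-- The term `g(...g(g(x, y), y)..., y)` with `k` occurrences of `g`. -/
def iterLeft (g : Term σ 2) : ℕ → Term σ 2
  | 0 => .var 0
  | k + 1 => g.subst ![iterLeft g k, .var 1]

theorem eval_iterLeft_succ (g : Term σ 2) (k : ℕ) (a b : A.carrier) :
    (g.iterLeft (k + 1)).eval A ![a, b] = g.eval A ![(g.iterLeft k).eval A ![a, b], b] := by
  simp [iterLeft, eval_subst₂, eval_var]

theorem eval_iterLeft (g : Term σ 2) (k : ℕ) (a b : A.carrier) :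
    (g.iterLeft k).eval A ![a, b] = (fun z => g.eval A ![z, b])^[k] a := by
  induction k with
  | zero => simp [iterLeft, eval_var]
  | succ k ih => rw [eval_iterLeft_succ, ih, Function.iterate_succ_apply']

end Term

namespace UAlgebra

open Term

variable {σ : Signature} {A : UAlgebra σ} {n k : ℕ}

section Basic

theorem IsClosed.eval_mem {S : Set A.carrier} (hS : A.IsClosed S) (t : Term σ n)
    {x : Fin n → A.carrier} (hx : ∀ i, x i ∈ S) : t.eval A x ∈ S := by
  induction t with
  | var i => exact hx i
  | app f ts ih => exact hS f _ ih

theorem IsClosed.eval₂_mem {S : Set A.carrier} (hS : A.IsClosed S) (t : Term σ 2)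
    {x y : A.carrier} (hx : x ∈ S) (hy : y ∈ S) : t.eval A ![x, y] ∈ S :=
  hS.eval_mem t fun i => by fin_cases i <;> assumption

theorem IsClosed.eval₃_mem {S : Set A.carrier} (hS : A.IsClosed S) (t : Term σ 3)
    {x y z : A.carrier} (hx : x ∈ S) (hy : y ∈ S) (hz : z ∈ S) : t.eval A ![x, y, z] ∈ S :=
  hS.eval_mem t fun i => by fin_cases i <;> assumption

theorem closureSet_subset {S T : Set A.carrier} (hT : A.IsClosed T) (h : S ⊆ T) :
    A.ClosureSet S ⊆ T := by
  intro x hx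
  induction hx with
  | base ha => exact h ha
  | app f x _ ih => exact hT f x ih

theorem left_mem_closureSet (a b : A.carrier) : a ∈ A.ClosureSet {a, b} :=
  Closure.base (Set.mem_insert a {b})

theorem right_mem_closureSet (a b : A.carrier) : b ∈ A.ClosureSet {a, b} :=
  Closure.base (Set.mem_insert_of_mem a rfl)

theorem closureSet_pair_subset {T : Set A.carrier} (hT : A.IsClosed T) {a b : A.carrier}
    (ha : a ∈ T) (hb : b ∈ T) : A.ClosureSet {a, b} ⊆ T :=
  closureSet_subset hT (Set.insert_subset ha (Set.singleton_subset_iff.2 hb))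

theorem mem_closureSet_pair_iff {a b x : A.carrier} :
    x ∈ A.ClosureSet {a, b} ↔ ∃ p : Term σ 2, p.eval A ![a, b] = x := by
  refine ⟨fun hx => ?_, ?_⟩
  · induction hx with
    | base ha =>
      rcases ha with rfl | rfl
      · exact ⟨.var 0, rfl⟩
      · exact ⟨.var 1, rfl⟩
    | app f x _ ih =>
      choose p hp using ih
      exact ⟨.app f p, by simp only [Term.eval, hp]⟩
  · rintro ⟨p, rfl⟩
    exact (A.closureSet_isClosed _).eval₂_mem p (left_mem_closureSet a b)
      (right_mem_closureSet a b)

theorem Idempotent.isClosed_singleton (hid : A.Idempotent) (a : A.carrier) :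
    A.IsClosed {a} := fun f x hx => by
  rw [show x = fun _ => a from funext hx]
  exact hid f a

theorem Idempotent.eval₂ (hid : A.Idempotent) (t : Term σ 2) (a : A.carrier) :
    t.eval A ![a, a] = a := (hid.isClosed_singleton a).eval₂_mem t rfl rfl

theorem Idempotent.eval₃ (hid : A.Idempotent) (t : Term σ 3) (a : A.carrier) :
    t.eval A ![a, a, a] = a := (hid.isClosed_singleton a).eval₃_mem t rfl rfl rfl

theorem eval_subalg {S : Set A.carrier} (hS : A.IsClosed S) (t : Term σ n)
    (x : Fin n → (A.subalg S hS).carrier) :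
    (t.eval (A.subalg S hS) x).1 = t.eval A fun i => (x i).1 := by
  induction t with
  | var i => rfl
  | app f ts ih =>
    change A.interp f _ = A.interp f _
    congr 1
    funext j
    exact ih j

theorem eval_quot (θ : Congruence A) (t : Term σ n) (x : Fin n → A.carrier) :
    t.eval (A.quot θ) (fun i => Quotient.mk θ.toSetoid (x i)) =
      Quotient.mk θ.toSetoid (t.eval A x) := by
  induction t with
  | var i => rfl
  | app f ts ih =>
    refine Quotient.sound (θ.compat f _ _ fun j => ?_)
    have := Quotient.exact ((Quotient.out_eq _).trans (ih j))
    exact this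

theorem eval_quot₂ (θ : Congruence A) (t : Term σ 2) (x y : A.carrier) :
    t.eval (A.quot θ) ![Quotient.mk θ.toSetoid x, Quotient.mk θ.toSetoid y] =
      Quotient.mk θ.toSetoid (t.eval A ![x, y]) := by
  rw [← eval_quot]
  congr 1
  funext i
  fin_cases i <;> rfl

theorem eval_quot₃ (θ : Congruence A) (t : Term σ 3) (x y z : A.carrier) :
    t.eval (A.quot θ) ![Quotient.mk θ.toSetoid x, Quotient.mk θ.toSetoid y,
        Quotient.mk θ.toSetoid z] =
      Quotient.mk θ.toSetoid (t.eval A ![x, y, z]) := by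
  rw [← eval_quot]
  congr 1
  funext i
  fin_cases i <;> rfl

theorem eval_Sg₂ (a b : A.carrier) (t : Term σ 2) (x y : (A.Sg {a, b}).carrier) :
    (t.eval (A.Sg {a, b}) ![x, y]).1 = t.eval A ![x.1, y.1] := by
  refine (eval_subalg _ t _).trans ?_
  congr 1
  funext i
  fin_cases i <;> rfl

theorem eval_Sg₃ (a b : A.carrier) (t : Term σ 3) (x y z : (A.Sg {a, b}).carrier) :
    (t.eval (A.Sg {a, b}) ![x, y, z]).1 = t.eval A ![x.1, y.1, z.1] := by
  refine (eval_subalg _ t _).trans ?_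
  congr 1
  funext i
  fin_cases i <;> rfl

theorem Congruence.isFull_of_rel_generators (hid : A.Idempotent) {a b : A.carrier}
    (θ : Congruence (A.Sg {a, b})) (h : θ.rel (A.sgA a b) (A.sgB a b)) : θ.IsFull := by
  have key : ∀ x (hx : Closure A {a, b} x), θ.rel ⟨x, hx⟩ (A.sgA a b) := by
    intro x hx
    induction hx with
    | base ha =>
      rcases ha with rfl | rfl
      · exact θ.refl _
      · exact θ.symm h
    | app f x hx ih =>
      have := θ.compat f (fun j => ⟨x j, hx j⟩) (fun _ => A.sgA a b) ih
      rwa [show (A.Sg {a, b}).interp f (fun _ => A.sgA a b) = A.sgA a b from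
        Subtype.ext (hid f a)] at this
  exact fun x y => θ.trans (key x.1 x.2) (θ.symm (key y.1 y.2))

end Basic

section Edges

/-- On an affine edge `ab` no term operation can satisfy the majority identities
with value `a`. -/
theorem IsAffEdge.false_of_eval_eq (hid : A.Idempotent) {a b : A.carrier}
    (h : A.IsAffEdge a b) (u : Term σ 3) (h₁ : u.eval A ![a, a, b] = a)
    (h₂ : u.eval A ![a, b, a] = a) (h₃ : u.eval A ![b, a, a] = a) : False := by
  obtain ⟨-, θ, ⟨hfull, -⟩, R, _, _, _, _, hterm, -⟩ := h
  apply hfull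
  apply θ.isFull_of_rel_generators hid
  obtain ⟨r, hr, hu⟩ := (hterm 3 (u.eval _)).1 ⟨u, fun _ => rfl⟩
  have e₁ := hu ![A.qa a b θ, A.qa a b θ, A.qb a b θ]
  have e₂ := hu ![A.qa a b θ, A.qb a b θ, A.qa a b θ]
  have e₃ := hu ![A.qb a b θ, A.qa a b θ, A.qa a b θ]
  rw [show u.eval _ ![A.qa a b θ, A.qa a b θ, A.qb a b θ] = A.qa a b θ from
    (eval_quot₃ θ u _ _ _).trans
      (congrArg _ (Subtype.ext ((eval_Sg₃ a b u _ _ _).trans h₁)))] at e₁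
  rw [show u.eval _ ![A.qa a b θ, A.qb a b θ, A.qa a b θ] = A.qa a b θ from
    (eval_quot₃ θ u _ _ _).trans
      (congrArg _ (Subtype.ext ((eval_Sg₃ a b u _ _ _).trans h₂)))] at e₂
  rw [show u.eval _ ![A.qb a b θ, A.qa a b θ, A.qa a b θ] = A.qa a b θ from
    (eval_quot₃ θ u _ _ _).trans
      (congrArg _ (Subtype.ext ((eval_Sg₃ a b u _ _ _).trans h₃)))] at e₃
  simp only [Fin.sum_univ_three, Matrix.cons_val] at e₁ e₂ e₃ hr
  have hone : ∀ v : ((A.Sg {a, b}).quot θ).carrier, r 0 • v + r 1 • v + r 2 • v = v := by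
    intro v
    rw [← add_smul, ← add_smul, hr, one_smul]
  have hab : A.qa a b θ = A.qb a b θ := by
    have ha := hone (A.qa a b θ)
    have hb := hone (A.qb a b θ)
    generalize A.qa a b θ = p at *
    generalize A.qb a b θ = q at *
    have f₁ : r 2 • p = r 2 • q := add_left_cancel (ha.trans e₁)
    have f₂ : r 1 • p = r 1 • q := by
      have := ha.trans e₂
      exact add_left_cancel (add_right_cancel this)
    have f₃ : r 0 • p = r 0 • q := by
      have := ha.trans e₃
      exact add_right_cancel (add_right_cancel this)
    rw [← ha, ← hb, f₁, f₂, f₃]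
  exact Quotient.exact hab

/-- The equality congruence. -/
def eqCongruence (A : UAlgebra σ) : Congruence A where
  rel x y := x = y
  refl _ := rfl
  symm h := h.symm
  trans h h' := h.trans h'
  compat f x y h := by rw [funext h]

theorem isEdge_of_semilattice (hid : A.Idempotent) {a b : A.carrier} (hab : a ≠ b)
    (t : Term σ 2) (h₁ : t.eval A ![a, b] = a) (h₂ : t.eval A ![b, a] = a) : A.IsEdge a b := by
  refine ⟨hab, eqCongruence _, fun h => hab (congrArg Subtype.val (h (A.sgA a b) (A.sgB a b))),
    .inr (.inr (.inl ⟨t, ?_⟩))⟩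
  have ev : ∀ x y z : (A.Sg {a, b}).carrier, t.eval A ![x.1, y.1] = z.1 →
      t.eval ((A.Sg {a, b}).quot (eqCongruence _))
        ![Quotient.mk (eqCongruence _).toSetoid x, Quotient.mk (eqCongruence _).toSetoid y] =
        Quotient.mk (eqCongruence _).toSetoid z := fun x y z h =>
    (eval_quot₂ _ t x y).trans (congrArg _ (Subtype.ext ((eval_Sg₂ a b t x y).trans h)))
  have haa := ev (A.sgA a b) (A.sgA a b) (A.sgA a b) (hid.eval₂ t a)
  have hbb := ev (A.sgB a b) (A.sgB a b) (A.sgB a b) (hid.eval₂ t b)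
  have hab' := ev (A.sgA a b) (A.sgB a b) (A.sgA a b) h₁
  have hba := ev (A.sgB a b) (A.sgA a b) (A.sgA a b) h₂
  refine ⟨?_, ?_, ?_⟩
  · rintro x (rfl | rfl)
    exacts [haa, hbb]
  · rintro x (rfl | rfl) y (rfl | rfl)
    exacts [rfl, hab'.trans hba.symm, hba.trans hab'.symm, rfl]
  · simp only [qa, qb]
    rintro x (rfl | rfl) y (rfl | rfl) z (rfl | rfl) <;> simp only [haa, hbb, hab', hba] <;> rfl

/-- The equivalence on `Sg {a, b}` with the blocks cut out by `W` and its complement, when it is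
preserved by the basic operations. -/
def splitCongruence (a b : A.carrier) (W : Set A.carrier)
    (h : ∀ (f : σ.ops) (x y : Fin (σ.arity f) → A.carrier),
      (∀ j, x j ∈ A.ClosureSet {a, b}) → (∀ j, y j ∈ A.ClosureSet {a, b}) →
      (∀ j, x j ∈ W ↔ y j ∈ W) → (A.interp f x ∈ W ↔ A.interp f y ∈ W)) :
    Congruence (A.Sg {a, b}) where
  rel x y := x.1 ∈ W ↔ y.1 ∈ W
  refl _ := Iff.rfl
  symm h := h.symm
  trans h h' := h.trans h'
  compat f x y hxy := h f _ _ (fun j => (x j).2) (fun j => (y j).2) hxy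

theorem isUnaryEdge_of_projections {a b : A.carrier} {W : Set A.carrier} (ha : a ∈ W)
    (hb : b ∉ W)
    (h : ∀ (n : ℕ) (t : Term σ n), ∃ i, ∀ x : Fin n → A.carrier,
      (∀ j, x j ∈ A.ClosureSet {a, b}) → (t.eval A x ∈ W ↔ x i ∈ W)) :
    A.IsUnaryEdge a b := by
  refine ⟨fun hab => hb (hab ▸ ha), splitCongruence a b W ?_, ⟨?_, ?_⟩, ?_⟩
  · intro f x y hx hy hxy
    obtain ⟨i, hi⟩ := h _ (.app f .var)
    exact (hi x hx).trans ((hxy i).trans (hi y hy).symm)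
  · exact fun hf => hb ((hf (A.sgA a b) (A.sgB a b)).1 ha)
  · intro η hle hη x y hxy
    by_contra hne
    apply hη
    have key : ∀ x y, η.rel x y → x.1 ∈ W → y.1 ∉ W → η.IsFull := by
      intro x y hxy hx hy
      have all : ∀ z, η.rel z x := fun z => by
        by_cases hz : z.1 ∈ W
        · exact hle _ _ ⟨fun _ => hx, fun _ => hz⟩
        · exact η.trans (hle _ _ ⟨fun h => absurd h hz, fun h => absurd h hy⟩) (η.symm hxy)
      exact fun u v => η.trans (all u) (η.symm (all v))
    by_cases hx : x.1 ∈ W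
    · exact key x y hxy hx fun hy => hne ⟨fun _ => hy, fun _ => hx⟩
    · refine key y x (η.symm hxy) ?_ hx
      by_contra hy
      exact hne ⟨fun h => absurd h hx, fun h => absurd h hy⟩
  · intro n t
    obtain ⟨i, hi⟩ := h n t
    refine ⟨i, fun x => ?_⟩
    obtain ⟨y, rfl⟩ : ∃ y : Fin n → (A.Sg {a, b}).carrier, x = fun j => Quotient.mk _ (y j) :=
      ⟨fun j => (x j).out, funext fun j => (Quotient.out_eq _).symm⟩
    rw [eval_quot]
    refine Quotient.sound ?_
    change (t.eval (A.Sg {a, b}) y).1 ∈ W ↔ (y i).1 ∈ W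
    rw [show (t.eval (A.Sg {a, b}) y).1 = _ from eval_subalg _ t y]
    exact hi _ fun j => (y j).2

theorem isEdge_of_majority {a b : A.carrier} {W : Set A.carrier} (ha : a ∈ W) (hb : b ∉ W)
    (h : ∀ (f : σ.ops) (x y : Fin (σ.arity f) → A.carrier),
      (∀ j, x j ∈ A.ClosureSet {a, b}) → (∀ j, y j ∈ A.ClosureSet {a, b}) →
      (∀ j, x j ∈ W ↔ y j ∈ W) → (A.interp f x ∈ W ↔ A.interp f y ∈ W))
    (hid : A.Idempotent) (t : Term σ 3)
    (h₁ : t.eval A ![a, a, b] ∈ W) (h₂ : t.eval A ![a, b, a] ∈ W)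
    (h₃ : t.eval A ![b, a, a] ∈ W) (h₄ : t.eval A ![b, b, a] ∉ W)
    (h₅ : t.eval A ![b, a, b] ∉ W) (h₆ : t.eval A ![a, b, b] ∉ W) : A.IsEdge a b := by
  refine ⟨fun hab => hb (hab ▸ ha), splitCongruence a b W h,
    fun hf => hb ((hf (A.sgA a b) (A.sgB a b)).1 ha), .inr (.inr (.inr ⟨t, ?_⟩))⟩
  have ev : ∀ x y z w : (A.Sg {a, b}).carrier, (t.eval A ![x.1, y.1, z.1] ∈ W ↔ w.1 ∈ W) →
      t.eval ((A.Sg {a, b}).quot (splitCongruence a b W h))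
        ![Quotient.mk (splitCongruence a b W h).toSetoid x,
          Quotient.mk (splitCongruence a b W h).toSetoid y,
          Quotient.mk (splitCongruence a b W h).toSetoid z] =
        Quotient.mk (splitCongruence a b W h).toSetoid w := fun x y z w hw => by
    rw [eval_quot₃]
    refine Quotient.sound ?_
    change (t.eval (A.Sg {a, b}) ![x, y, z]).1 ∈ W ↔ w.1 ∈ W
    rwa [eval_Sg₃]
  rintro x (rfl | rfl) y (rfl | rfl)
  · exact ⟨ev _ _ _ _ (by simp [sgA, hid.eval₃]), ev _ _ _ _ (by simp [sgA, hid.eval₃]),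
      ev _ _ _ _ (by simp [sgA, hid.eval₃])⟩
  · exact ⟨ev _ _ _ _ (iff_of_true h₁ ha), ev _ _ _ _ (iff_of_true h₂ ha),
      ev _ _ _ _ (iff_of_true h₃ ha)⟩
  · exact ⟨ev _ _ _ _ (iff_of_false h₄ hb), ev _ _ _ _ (iff_of_false h₅ hb),
      ev _ _ _ _ (iff_of_false h₆ hb)⟩
  · exact ⟨ev _ _ _ _ (by simp [sgB, hid.eval₃]), ev _ _ _ _ (by simp [sgB, hid.eval₃]),
      ev _ _ _ _ (by simp [sgB, hid.eval₃])⟩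

end Edges

section Absorption

/-- Term operations satisfying the two Mal'tsev identities on prescribed pairs can be patched
together: the first identity on the pairs related by `L`, the second on those related by `J`. -/
theorem exists_term_forall_pairs [Finite A.carrier] (hid : A.Idempotent)
    {L J : A.carrier → A.carrier → Prop}
    (hL : ∀ a b, L a b → ∀ t : Term σ 3, L a (t.eval A ![a, b, b]))
    (hJ : ∀ c d, J c d → ∀ t : Term σ 3, J (t.eval A ![c, c, d]) d)
    (h : ∀ a b c d, L a b → J c d →
      ∃ t : Term σ 3, t.eval A ![a, b, b] = a ∧ t.eval A ![c, c, d] = d) :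
    ∃ t : Term σ 3, (∀ a b, L a b → t.eval A ![a, b, b] = a) ∧
      ∀ c d, J c d → t.eval A ![c, c, d] = d := by
  have left : ∀ c d, J c d → ∃ t : Term σ 3, (∀ a b, L a b → t.eval A ![a, b, b] = a) ∧
      t.eval A ![c, c, d] = d := by
    intro c d hcd
    have key : ∀ S : Set (A.carrier × A.carrier), S.Finite → ∃ t : Term σ 3,
        (∀ p ∈ S, L p.1 p.2 → t.eval A ![p.1, p.2, p.2] = p.1) ∧ t.eval A ![c, c, d] = d := by
      intro S hS
      induction S, hS using Set.Finite.induction_on with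
      | empty => exact ⟨.var 2, by simp, rfl⟩
      | @insert p S _ _ ih =>
        obtain ⟨t, ht, htd⟩ := ih
        by_cases hp : L p.1 p.2
        · obtain ⟨s, hs, hsd⟩ := h _ _ c d (hL _ _ hp t) hcd
          refine ⟨s.subst ![.var 0, t.subst ![.var 0, .var 1, .var 1], t], ?_, ?_⟩
          · rintro q (rfl | hq) hLq
            · simpa [eval_subst₃, eval_var] using hs
            · simp [eval_subst₃, eval_var, ht q hq hLq, hid.eval₃]
          · simp [eval_subst₃, eval_var, hid.eval₃, htd, hsd]
        · refine ⟨t, ?_, htd⟩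
          rintro q (rfl | hq) hLq
          exacts [absurd hLq hp, ht q hq hLq]
    obtain ⟨t, ht, htd⟩ := key Set.univ Set.finite_univ
    exact ⟨t, fun a b => ht (a, b) (Set.mem_univ _), htd⟩
  have key : ∀ S : Set (A.carrier × A.carrier), S.Finite → ∃ t : Term σ 3,
      (∀ a b, L a b → t.eval A ![a, b, b] = a) ∧
        ∀ p ∈ S, J p.1 p.2 → t.eval A ![p.1, p.1, p.2] = p.2 := by
    intro S hS
    induction S, hS using Set.Finite.induction_on with
    | empty => exact ⟨.var 0, fun _ _ _ => rfl, by simp⟩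
    | @insert p S _ _ ih =>
      obtain ⟨t, htl, ht⟩ := ih
      by_cases hp : J p.1 p.2
      · obtain ⟨s, hsl, hs⟩ := left _ _ (hJ _ _ hp t)
        refine ⟨s.subst ![t, t.subst ![.var 1, .var 1, .var 2], .var 2], ?_, ?_⟩
        · intro a b hab
          simp [eval_subst₃, eval_var, htl a b hab, hid.eval₃, hsl a b hab]
        · rintro q (rfl | hq) hJq
          · simpa [eval_subst₃, eval_var] using hs
          · simp [eval_subst₃, eval_var, ht q hq hJq, hid.eval₃]
      · refine ⟨t, htl, ?_⟩
        rintro q (rfl | hq) hJq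
        exacts [absurd hJq hp, ht q hq hJq]
  obtain ⟨t, htl, ht⟩ := key Set.univ Set.finite_univ
  exact ⟨t, htl, fun c d => ht (c, d) (Set.mem_univ _)⟩

/-- The value of `t` on `C` lies in `W` as soon as all arguments with index in `I` do. -/
def Absorbs (C W : Set A.carrier) (t : Term σ n) (I : Set (Fin n)) : Prop :=
  ∀ x : Fin n → A.carrier, (∀ i, x i ∈ C) → (∀ i ∈ I, x i ∈ W) → t.eval A x ∈ W

/-- A subuniverse `W` of `C` such that any element of `W` generates `C` together with any element
of `C` outside of `W`. -/
structure IsCenter (A : UAlgebra σ) (C W : Set A.carrier) : Prop where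
  closed : A.IsClosed C
  closed_center : A.IsClosed W
  subset : W ⊆ C
  nonempty : W.Nonempty
  exists_notMem : ∃ d ∈ C, d ∉ W
  generates : ∀ z ∈ W, ∀ x ∈ C, x ∉ W → ∀ y ∈ C, ∃ p : Term σ 2, p.eval A ![z, x] = y

variable {C W : Set A.carrier}

theorem Absorbs.mono {t : Term σ n} {I I' : Set (Fin n)} (h : Absorbs C W t I) (hI : I ⊆ I') :
    Absorbs C W t I' :=
  fun x hx hxI => h x hx fun i hi => hxI i (hI hi)

theorem Absorbs.subst_var {t : Term σ n} {s : Fin n → Fin k} {K : Set (Fin k)}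
    (h : Absorbs C W t (s ⁻¹' K)) : Absorbs C W (t.subst fun i => .var (s i)) K := by
  intro x hx hxK
  rw [eval_subst]
  exact h _ (fun i => hx (s i)) fun i hi => hxK (s i) hi

theorem Absorbs.eval₂ {t : Term σ 2} {I : Set (Fin 2)} (h : Absorbs C W t I) {x y : A.carrier}
    (hx : x ∈ C) (hy : y ∈ C) (hI : ∀ i ∈ I, ![x, y] i ∈ W) : t.eval A ![x, y] ∈ W :=
  h _ (fun i => by fin_cases i <;> assumption) hI

theorem Absorbs.eval₃ {t : Term σ 3} {I : Set (Fin 3)} (h : Absorbs C W t I) {x y z : A.carrier}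
    (hx : x ∈ C) (hy : y ∈ C) (hz : z ∈ C) (hI : ∀ i ∈ I, ![x, y, z] i ∈ W) :
    t.eval A ![x, y, z] ∈ W :=
  h _ (fun i => by fin_cases i <;> assumption) hI

/-- No term operation acts as a semilattice operation on a two-element set. -/
def NoSemilattice (A : UAlgebra σ) : Prop :=
  ∀ c d : A.carrier, c ≠ d → ∀ F : Term σ 2,
    F.eval A ![c, d] = c → F.eval A ![d, c] = c → False

theorem IsCenter.false_of_binary_absorbs [Finite A.carrier] (hC : IsCenter A C W)
    (hSL : NoSemilattice A) {m : Term σ 3}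
    (hm : ∀ x ∈ W, ∀ y ∈ W, m.eval A ![x, y, y] = x ∧ m.eval A ![x, x, y] = y)
    (hm₂ : Absorbs C W m {2}) {f : Term σ 2} (hf₀ : Absorbs C W f {0})
    (hf₁ : Absorbs C W f {1}) : False := by
  set g : Term σ 2 := m.subst ![.var 1, f, f] with hg
  have eg : ∀ x y, g.eval A ![x, y] = m.eval A ![y, f.eval A ![x, y], f.eval A ![x, y]] := by
    intro x y
    simp [hg, eval_subst₃, eval_var]
  have hfW : ∀ x ∈ C, ∀ y ∈ C, x ∈ W ∨ y ∈ W → f.eval A ![x, y] ∈ W := by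
    rintro x hx y hy (h | h)
    · exact hf₀.eval₂ hx hy (by simpa using h)
    · exact hf₁.eval₂ hx hy (by simpa using h)
  have hgW : ∀ x ∈ C, ∀ y ∈ C, x ∈ W ∨ y ∈ W → g.eval A ![x, y] ∈ W := by
    intro x hx y hy h
    have := hfW x hx y hy h
    rw [eg]
    exact hm₂.eval₃ hy (hC.subset this) (hC.subset this) (by simpa using this)
  have hg₂ : ∀ x ∈ W, ∀ y ∈ W, g.eval A ![x, y] = y := by
    intro x hx y hy
    rw [eg]
    exact (hm y hy _ (hfW x (hC.subset hx) y (hC.subset hy) (.inl hx))).1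
  obtain ⟨c₀, hc₀⟩ := hC.nonempty
  obtain ⟨d, hd, hdW⟩ := hC.exists_notMem
  set Q : A.carrier → A.carrier := fun z => g.eval A ![z, d]
  have hQ : ∀ i, Q^[i] c₀ ∈ W := by
    intro i
    induction i with
    | zero => exact hc₀
    | succ i ih =>
      rw [Function.iterate_succ_apply']
      exact hgW _ (hC.subset ih) d hd (.inl ih)
  obtain ⟨c, hc, j, hj⟩ : ∃ c ∈ W, ∃ j, Q^[j + 1] c = c := by
    obtain ⟨i, j, hij, h⟩ := Finite.exists_ne_map_eq_of_infinite fun i => Q^[i] c₀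
    wlog hlt : i < j generalizing i j
    · exact this j i hij.symm h.symm (by omega)
    refine ⟨_, hQ i, j - i - 1, ?_⟩
    rw [← Function.iterate_add_apply, show j - i - 1 + 1 + i = j by omega]
    exact h.symm
  have hF₁ : (g.iterLeft (j + 1 + (j + 1))).eval A ![c, d] = c := by
    rw [eval_iterLeft, Function.iterate_add_apply]
    exact (congrArg _ hj).trans hj
  have hF₂ : ∀ i, (g.iterLeft (i + 1)).eval A ![d, c] ∈ W := by
    intro i
    induction i with
    | zero =>
      rw [eval_iterLeft_succ]
      exact hgW _ hd c (hC.subset hc) (.inr hc)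
    | succ i ih =>
      rw [eval_iterLeft_succ]
      exact hgW _ (hC.subset ih) c (hC.subset hc) (.inr hc)
  refine hSL c d (fun h => hdW (h ▸ hc)) _ hF₁ ?_
  rw [show j + 1 + (j + 1) = j + j + 1 + 1 by omega, eval_iterLeft_succ]
  exact hg₂ _ (hF₂ _) _ hc

theorem IsCenter.not_absorbs_and_compl [Finite A.carrier] (hC : IsCenter A C W)
    (hSL : NoSemilattice A) {m : Term σ 3}
    (hm : ∀ x ∈ W, ∀ y ∈ W, m.eval A ![x, y, y] = x ∧ m.eval A ![x, x, y] = y)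
    (hm₂ : Absorbs C W m {2}) (t : Term σ n) (I : Set (Fin n)) :
    ¬ (Absorbs C W t I ∧ Absorbs C W t Iᶜ) := by
  classical
  rintro ⟨h, h'⟩
  refine hC.false_of_binary_absorbs hSL hm hm₂
    (f := t.subst fun i => .var (if i ∈ I then 0 else 1)) ?_ ?_
  · refine Absorbs.subst_var (h.mono fun i hi => ?_)
    simp [hi]
  · refine Absorbs.subst_var (h'.mono fun i hi => ?_)
    simpa using hi

/-- A binary relation between `B` and `C` compatible with the operations. -/
structure IsLinked (A : UAlgebra σ) (B C : Set A.carrier) (R : A.carrier → A.carrier → Prop) :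
    Prop where
  closed_left : A.IsClosed B
  closed_right : A.IsClosed C
  mem : ∀ {x y}, R x y → x ∈ B ∧ y ∈ C
  compat : ∀ (f : σ.ops) (x y : Fin (σ.arity f) → A.carrier),
    (∀ j, R (x j) (y j)) → R (A.interp f x) (A.interp f y)
  full_left : ∃ b ∈ B, ∀ y ∈ C, R b y
  full_right : ∃ c ∈ C, ∀ x ∈ B, R x c
  not_full : ∃ x ∈ B, ∃ y ∈ C, ¬ R x y
  fill : ∀ {x x' y y'}, R x y → R x' y → R x' y' →
    A.ClosureSet {x, x'} ≠ B ∨ A.ClosureSet {y, y'} ≠ C → R x y'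

namespace IsLinked

variable {B : Set A.carrier} {R : A.carrier → A.carrier → Prop}

theorem flip (h : IsLinked A B C R) : IsLinked A C B fun y x => R x y where
  closed_left := h.closed_right
  closed_right := h.closed_left
  mem hR := (h.mem hR).symm
  compat f x y := h.compat f y x
  full_left := h.full_right
  full_right := h.full_left
  not_full := by
    obtain ⟨x, hx, y, hy, hxy⟩ := h.not_full
    exact ⟨y, hy, x, hx, hxy⟩
  fill h₁ h₂ h₃ hne := h.fill h₃ h₂ h₁ <| by
    rw [Set.pair_comm, or_comm]
    nth_rewrite 1 [Set.pair_comm]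
    exact hne

theorem eval (h : IsLinked A B C R) (t : Term σ n) {x y : Fin n → A.carrier}
    (hxy : ∀ i, R (x i) (y i)) : R (t.eval A x) (t.eval A y) := by
  induction t with
  | var i => exact hxy i
  | app f ts ih => exact h.compat f _ _ ih

/-- The elements of `B` related to all of `C`. -/
def center (B C : Set A.carrier) (R : A.carrier → A.carrier → Prop) : Set A.carrier :=
  {x | x ∈ B ∧ ∀ y ∈ C, R x y}

theorem closed_fiber (h : IsLinked A B C R) (hid : A.Idempotent) (x : A.carrier) :
    A.IsClosed {y | R x y} := by
  intro f y hy
  have := h.compat f (fun _ => x) y hy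
  rwa [hid] at this

theorem mem_center_or_mem_center (h : IsLinked A B C R) (hid : A.Idempotent) {x y : A.carrier}
    (hxy : R x y) : x ∈ center B C R ∨ y ∈ center C B fun y x => R x y := by
  by_contra! hne
  obtain ⟨hx, hy⟩ := hne
  simp only [center, Set.mem_ofPred_eq, (h.mem hxy).1, (h.mem hxy).2, true_and, not_forall] at hx hy
  obtain ⟨y', hy', hxy'⟩ := hx
  obtain ⟨x', hx', hxy''⟩ := hy
  obtain ⟨c, hc, hcR⟩ := h.full_right
  by_cases hgen : A.ClosureSet {c, y} = C
  · rw [← hgen] at hy'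
    exact hxy' (closureSet_pair_subset (h.closed_fiber hid x) (hcR x (h.mem hxy).1) hxy hy')
  · exact hxy'' (h.fill (hcR x' hx') (hcR x (h.mem hxy).1) hxy (.inr hgen))

theorem isCenter (h : IsLinked A B C R) (hid : A.Idempotent) :
    IsCenter A B (center B C R) where
  closed := h.closed_left
  closed_center f x hx := by
    refine ⟨h.closed_left f x fun j => (hx j).1, fun y hy => ?_⟩
    have := h.compat f x (fun _ => y) fun j => (hx j).2 y hy
    rwa [hid] at this
  subset _ hx := hx.1
  nonempty := h.full_left
  exists_notMem := by
    obtain ⟨x, hx, y, hy, hxy⟩ := h.not_full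
    exact ⟨x, hx, fun h => hxy (h.2 y hy)⟩
  generates z hz x hx hxZ y hy := by
    simp only [center, Set.mem_ofPred_eq, hx, true_and, not_forall] at hxZ
    obtain ⟨y', hy', hxy'⟩ := hxZ
    obtain ⟨c, hc, hcR⟩ := h.full_right
    rw [← mem_closureSet_pair_iff]
    by_contra hgen
    refine hxy' (h.fill (hcR x hx) (hcR z hz.1) (hz.2 y' hy') (.inl fun heq => hgen ?_))
    rwa [Set.pair_comm, heq]

theorem absorbs_or_absorbs (h : IsLinked A B C R) (hid : A.Idempotent) (t : Term σ n)
    (I : Set (Fin n)) : Absorbs B (center B C R) t I ∨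
      Absorbs C (center C B fun y x => R x y) t Iᶜ := by
  by_contra! hne
  obtain ⟨h₁, h₂⟩ := hne
  simp only [Absorbs, not_forall] at h₁ h₂
  obtain ⟨x, hx, hxI, hxt⟩ := h₁
  obtain ⟨y, hy, hyI, hyt⟩ := h₂
  have : R (t.eval A x) (t.eval A y) := h.eval t fun i => by
    by_cases hi : i ∈ I
    · exact (hxI i hi).2 _ (hy i)
    · exact (hyI i hi).2 _ (hx i)
  exact (h.mem_center_or_mem_center hid this).elim hxt hyt

end IsLinked

end Absorption

section SelfDual

variable {C W : Set A.carrier}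

/-- A center for which absorption is self-dual, together with a term operation that is half
Mal'tsev on it and absorbing in the last argument. -/
structure IsSelfDualCenter (A : UAlgebra σ) (C W : Set A.carrier) (m : Term σ 3) : Prop extends
    IsCenter A C W where
  absorbs_compl : ∀ {n : ℕ} (t : Term σ n) (I : Set (Fin n)),
    Absorbs C W t Iᶜ ↔ ¬ Absorbs C W t I
  eval_eq : ∀ x ∈ W, ∀ y ∈ W, m.eval A ![x, y, y] = x
  absorbs : Absorbs C W m {2}

namespace IsSelfDualCenter

variable {m : Term σ 3}

theorem absorbs_subst_var (h : IsSelfDualCenter A C W m) (t : Term σ n) (s : Fin n → Fin k)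
    (K : Set (Fin k)) :
    Absorbs C W (t.subst fun i => .var (s i)) K ↔ Absorbs C W t (s ⁻¹' K) := by
  refine ⟨fun hK => ?_, Absorbs.subst_var⟩
  by_contra hne
  rw [← h.absorbs_compl, ← Set.preimage_compl] at hne
  exact (h.absorbs_compl _ K).1 hne.subst_var hK

theorem exists_eval_eq (h : IsSelfDualCenter A C W m) (hid : A.Idempotent) {c d : A.carrier}
    (hc : c ∈ W) (hd : d ∈ C) (hdW : d ∉ W) {U : Set (Fin n → A.carrier)}
    {v : Fin n → A.carrier} {p₀ p₁ : Term σ n} (h₀U : ∀ u ∈ U, p₀.eval A u = c)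
    (h₀v : p₀.eval A v = d) (h₁U : ∀ u ∈ U, p₁.eval A u ∈ W) (h₁v : p₁.eval A v ∈ W) :
    ∃ p : Term σ n, (∀ u ∈ U, p.eval A u = c) ∧ p.eval A v = c := by
  have hcC := h.subset hc
  obtain ⟨q, hq⟩ := h.generates _ h₁v d hd hdW c hcC
  set p₂ := q.subst ![p₁, p₀] with hp₂
  have h₂U : ∀ u ∈ U, p₂.eval A u ∈ W := fun u hu => by
    rw [hp₂, eval_subst₂, h₀U u hu]
    exact h.closed_center.eval₂_mem q (h₁U u hu) hc
  have h₂v : p₂.eval A v = c := by rw [hp₂, eval_subst₂, h₀v, hq]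
  set p₃ := m.subst ![p₀, p₂, p₂] with hp₃
  have h₃U : ∀ u ∈ U, p₃.eval A u = c := fun u hu => by
    rw [hp₃, eval_subst₃, h₀U u hu, h.eval_eq c hc _ (h₂U u hu)]
  have h₃v : p₃.eval A v ∈ W := by
    rw [hp₃, eval_subst₃, h₀v, h₂v]
    exact h.absorbs.eval₃ hd hcC hcC (by simpa using hc)
  obtain ⟨q', hq'⟩ := h.generates _ h₃v d hd hdW c hcC
  refine ⟨q'.subst ![p₃, p₀], fun u hu => ?_, ?_⟩
  · rw [eval_subst₂, h₃U u hu, h₀U u hu, hid.eval₂]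
  · rw [eval_subst₂, h₀v, hq']

theorem eval_swap_notMem (h : IsSelfDualCenter A C W m) (hid : A.Idempotent)
    (hSL : NoSemilattice A) {c d : A.carrier} (hc : c ∈ W) (hd : d ∈ C) (hdW : d ∉ W)
    (s : Term σ 2) (h₁ : s.eval A ![c, d] ∈ W) : s.eval A ![d, c] ∉ W := by
  intro h₂
  obtain ⟨p, hpU, hpv⟩ := h.exists_eval_eq hid hc hd hdW (U := {![c, d]}) (v := ![d, c])
    (p₀ := .var 0) (p₁ := s) (by simp [eval_var]) rfl (by simpa using h₁) h₂
  exact hSL c d (fun hcd => hdW (hcd ▸ hc)) p (hpU _ rfl) hpv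

theorem eval_mem_iff (h : IsSelfDualCenter A C W m) (hid : A.Idempotent)
    (hSL : NoSemilattice A) (t : Term σ n) {x : Fin n → A.carrier} (hx : ∀ i, x i ∈ C) :
    t.eval A x ∈ W ↔ Absorbs C W t {j | x j ∈ W} := by
  refine ⟨fun ht => ?_, fun ht => ht x hx fun _ hi => hi⟩
  by_contra hne
  rw [← h.absorbs_compl] at hne
  obtain ⟨c, hc⟩ := h.nonempty
  obtain ⟨d, hd, hdW⟩ := h.exists_notMem
  choose p hp using fun j => h.generates c hc d hd hdW (x j) (hx j)
  refine h.eval_swap_notMem hid hSL hc hd hdW (t.subst p) ?_ ?_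
  · rw [eval_subst]
    simpa only [hp] using ht
  · rw [eval_subst]
    refine hne _ (fun j => h.closed.eval₂_mem _ hd (h.subset hc)) fun j hj => ?_
    by_cases h₀ : Absorbs C W (p j) {0}
    · refine absurd ?_ hj
      change x j ∈ W
      rw [← hp j]
      exact h₀.eval₂ (h.subset hc) hd (by simpa using hc)
    · rw [← h.absorbs_compl] at h₀
      refine h₀.eval₂ hd (h.subset hc) fun i hi => ?_
      fin_cases i
      · exact absurd rfl hi
      · exact hc

theorem interp_mem_iff (h : IsSelfDualCenter A C W m) (hid : A.Idempotent)
    (hSL : NoSemilattice A) (f : σ.ops) {x y : Fin (σ.arity f) → A.carrier}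
    (hx : ∀ i, x i ∈ C) (hy : ∀ i, y i ∈ C) (hxy : ∀ i, x i ∈ W ↔ y i ∈ W) :
    A.interp f x ∈ W ↔ A.interp f y ∈ W := by
  refine (h.eval_mem_iff hid hSL (.app f .var) hx).trans
    (Iff.trans ?_ (h.eval_mem_iff hid hSL (.app f .var) hy).symm)
  simp only [hxy]

theorem closureSet_subset (h : IsSelfDualCenter A C W m) {c d : A.carrier} (hc : c ∈ W)
    (hd : d ∈ C) : A.ClosureSet {c, d} ⊆ C :=
  closureSet_pair_subset h.closed (h.subset hc) hd

/-- A term whose singletons of arguments do not absorb is a majority operation modulo the center. -/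
theorem exists_absorbs_singleton_of_ternary (h : IsSelfDualCenter A C W m) (hid : A.Idempotent)
    (hSL : NoSemilattice A) (hedge : ∀ a b : A.carrier, A.IsEdge a b → A.IsAffEdge a b)
    (t : Term σ 3) : ∃ i, Absorbs C W t {i} := by
  by_contra! hne
  obtain ⟨c, hc⟩ := h.nonempty
  obtain ⟨d, hd, hdW⟩ := h.exists_notMem
  have hcC := h.subset hc
  have one : ∀ (i : Fin 3) (x : Fin 3 → A.carrier), (∀ j, x j ∈ C) →
      (∀ j, x j ∈ W ↔ j = i) → t.eval A x ∉ W := fun i x hx hi => by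
    rw [h.eval_mem_iff hid hSL t hx]
    simp only [hi]
    exact hne i
  have two : ∀ (i : Fin 3) (x : Fin 3 → A.carrier), (∀ j, x j ∈ C) →
      (∀ j, x j ∈ W ↔ j ≠ i) → t.eval A x ∈ W := fun i x hx hi => by
    rw [h.eval_mem_iff hid hSL t hx]
    simp only [hi]
    exact (h.absorbs_compl t {i}).2 (hne i)
  have mem : ∀ x y z : A.carrier, x ∈ C → y ∈ C → z ∈ C → ∀ j, ![x, y, z] j ∈ C := by
    intro x y z hx hy hz j
    fin_cases j <;> assumption
  have h₁ := two 2 ![c, c, d] (mem _ _ _ hcC hcC hd) fun j => by fin_cases j <;> simp [hc, hdW]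
  have h₂ := two 1 ![c, d, c] (mem _ _ _ hcC hd hcC) fun j => by fin_cases j <;> simp [hc, hdW]
  have h₃ := two 0 ![d, c, c] (mem _ _ _ hd hcC hcC) fun j => by fin_cases j <;> simp [hc, hdW]
  have h₄ := one 2 ![d, d, c] (mem _ _ _ hd hd hcC) fun j => by fin_cases j <;> simp [hc, hdW]
  have h₅ := one 1 ![d, c, d] (mem _ _ _ hd hcC hd) fun j => by fin_cases j <;> simp [hc, hdW]
  have h₆ := one 0 ![c, d, d] (mem _ _ _ hcC hd hd) fun j => by fin_cases j <;> simp [hc, hdW]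
  have hsub := h.closureSet_subset hc hd
  have haff := hedge c d <| isEdge_of_majority hc hdW
    (fun f x y hx hy hxy => h.interp_mem_iff hid hSL f (fun j => hsub (hx j))
      (fun j => hsub (hy j)) hxy) hid t h₁ h₂ h₃ h₄ h₅ h₆
  obtain ⟨u, huU, huv⟩ := h.exists_eval_eq hid hc hd hdW (U := {![c, c, d], ![c, d, c]})
    (v := ![d, c, c]) (p₀ := .var 0) (p₁ := t) (by simp [eval_var]) rfl (by simp [h₁, h₂]) h₃
  exact haff.false_of_eval_eq hid u (huU _ (.inl rfl)) (huU _ (.inr rfl)) huv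

theorem exists_absorbs_singleton (h : IsSelfDualCenter A C W m) (hid : A.Idempotent)
    (hSL : NoSemilattice A) (hedge : ∀ a b : A.carrier, A.IsEdge a b → A.IsAffEdge a b)
    (t : Term σ n) : ∃ i, Absorbs C W t {i} := by
  classical
  have huniv : Absorbs C W t Set.univ := fun x _ hx =>
    h.closed_center.eval_mem t fun i => hx i (Set.mem_univ i)
  obtain ⟨I, hI, hmin⟩ := (Set.toFinite {I : Set (Fin n) | Absorbs C W t I}).exists_minimal
    ⟨_, huniv⟩
  have hne : I.Nonempty := by
    rw [Set.nonempty_iff_ne_empty]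
    rintro rfl
    exact (h.absorbs_compl t ∅).1 (by rwa [Set.compl_empty]) hI
  obtain ⟨i, hi⟩ := hne
  refine ⟨i, ?_⟩
  set s : Fin n → Fin 3 := fun j => if j = i then 0 else if j ∈ I then 1 else 2 with hs
  obtain ⟨k, hk⟩ := h.exists_absorbs_singleton_of_ternary hid hSL hedge
    (t.subst fun j => .var (s j))
  rw [h.absorbs_subst_var] at hk
  fin_cases k
  · refine hk.mono fun j hj => ?_
    by_contra hne
    simp only [hs, Set.mem_preimage, Set.mem_singleton_iff] at hj hne
    split_ifs at hj <;> simp_all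
  · have hsub : s ⁻¹' {1} ⊆ I \ {i} := fun j hj => by
      simp only [hs, Set.mem_preimage, Set.mem_singleton_iff] at hj
      split_ifs at hj <;> simp_all
    exact absurd rfl (hmin (hk.mono hsub) Set.sdiff_subset hi).2
  · refine absurd hI ((h.absorbs_compl t I).1 (hk.mono fun j hj => ?_))
    simp only [hs, Set.mem_preimage, Set.mem_singleton_iff] at hj
    split_ifs at hj <;> simp_all

theorem exists_eval_mem_iff (h : IsSelfDualCenter A C W m) (hid : A.Idempotent)
    (hSL : NoSemilattice A) (hedge : ∀ a b : A.carrier, A.IsEdge a b → A.IsAffEdge a b)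
    (t : Term σ n) : ∃ i, ∀ x : Fin n → A.carrier, (∀ j, x j ∈ C) →
      (t.eval A x ∈ W ↔ x i ∈ W) := by
  obtain ⟨i, hi⟩ := h.exists_absorbs_singleton hid hSL hedge t
  refine ⟨i, fun x hx => ⟨fun ht => ?_, fun hxi => hi x hx (by simpa using hxi)⟩⟩
  by_contra hxi
  rw [h.eval_mem_iff hid hSL t hx] at ht
  refine (h.absorbs_compl t {i}).1 (ht.mono fun j hj hji => hxi ?_) hi
  rw [← Set.mem_singleton_iff.1 hji]
  exact hj

theorem false_of_omitsType1 (h : IsSelfDualCenter A C W m) (hid : A.Idempotent)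
    (h1 : A.OmitsType1) (hSL : NoSemilattice A)
    (hedge : ∀ a b : A.carrier, A.IsEdge a b → A.IsAffEdge a b) : False := by
  obtain ⟨c, hc⟩ := h.nonempty
  obtain ⟨d, hd, hdW⟩ := h.exists_notMem
  refine h1 C h.closed ⟨c, h.subset hc⟩ ⟨d, hd⟩
    (isUnaryEdge_of_projections (W := {x | x.1 ∈ W}) hc hdW fun n t => ?_)
  obtain ⟨i, hi⟩ := h.exists_eval_mem_iff hid hSL hedge t
  refine ⟨i, fun x _ => ?_⟩
  change (t.eval _ x).1 ∈ W ↔ (x i).1 ∈ W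
  rw [eval_subalg]
  exact hi _ fun j => (x j).2

end IsSelfDualCenter

end SelfDual

section Maltsev

theorem noSemilattice_of_isEdge_imp_isAffEdge (hid : A.Idempotent)
    (hedge : ∀ a b : A.carrier, A.IsEdge a b → A.IsAffEdge a b) : NoSemilattice A := by
  intro c d hcd F h₁ h₂
  refine (hedge c d (isEdge_of_semilattice hid hcd F h₁ h₂)).false_of_eval_eq hid
    (F.subst ![F.subst ![.var 0, .var 1], .var 2]) ?_ ?_ ?_ <;>
  simp [eval_subst₂, eval_var, hid.eval₂, h₁, h₂]

section Linked

variable [Finite A.carrier] {B C : Set A.carrier} {R : A.carrier → A.carrier → Prop}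

theorem IsLinked.false_of_isMaltsev_left (hR : IsLinked A B C R) (hid : A.Idempotent)
    (hSL : NoSemilattice A) (m : Term σ 3)
    (hB : ∀ x ∈ B, ∀ y ∈ B, m.eval A ![x, y, y] = x ∧ m.eval A ![x, x, y] = y)
    (hC : ∀ x ∈ center C B fun y x => R x y, ∀ y ∈ center C B fun y x => R x y,
      m.eval A ![x, y, y] = x ∧ m.eval A ![x, x, y] = y) : False := by
  have cB := hR.isCenter hid
  have cC := hR.flip.isCenter hid
  obtain ⟨b, hb⟩ := cB.nonempty
  obtain ⟨a, ha, haZ⟩ := cB.exists_notMem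
  have hbB := cB.subset hb
  have h₀ := (hR.absorbs_or_absorbs hid m {1, 2}).resolve_left fun h => haZ <| by
    rw [← (hB a ha b hbB).1]
    exact h.eval₃ ha hbB hbB (by simpa using hb)
  have h₂ := (hR.absorbs_or_absorbs hid m {0, 1}).resolve_left fun h => haZ <| by
    rw [← (hB b hbB a ha).2]
    exact h.eval₃ hbB hbB ha (by simpa using hb)
  have h₀' : Absorbs C _ m {0} := h₀.mono fun i hi => by fin_cases i <;> simp_all
  have h₂' : Absorbs C _ m {2} := h₂.mono fun i hi => by fin_cases i <;> simp_all
  refine cC.false_of_binary_absorbs hSL hC h₂'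
    (f := m.subst fun i => .var (![0, 1, 1] i)) (Absorbs.subst_var (h₀'.mono ?_))
    (Absorbs.subst_var (h₂'.mono ?_))
  · rintro _ rfl
    rfl
  · rintro _ rfl
    rfl

theorem IsLinked.isSelfDualCenter (hR : IsLinked A B C R) (hid : A.Idempotent)
    (hSL : NoSemilattice A) {m : Term σ 3}
    (hmB : ∀ x ∈ B, ∀ y ∈ B, m.eval A ![x, x, y] = y)
    (hmC : ∀ x ∈ C, ∀ y ∈ C, m.eval A ![x, x, y] = y)
    (hB : ∀ x ∈ center B C R, ∀ y ∈ center B C R, m.eval A ![x, y, y] = x)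
    (hC : ∀ x ∈ center C B fun y x => R x y, ∀ y ∈ center C B fun y x => R x y,
      m.eval A ![x, y, y] = x) :
    IsSelfDualCenter A C (center C B fun y x => R x y) m := by
  have cB := hR.isCenter hid
  have cC := hR.flip.isCenter hid
  have not₂ : ∀ {D Z : Set A.carrier}, IsCenter A D Z →
      (∀ x ∈ D, ∀ y ∈ D, m.eval A ![x, x, y] = y) → ¬ Absorbs D Z m {0, 1} := by
    intro D Z hD hm h
    obtain ⟨b, hb⟩ := hD.nonempty
    obtain ⟨a, ha, haZ⟩ := hD.exists_notMem
    apply haZ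
    rw [← hm b (hD.subset hb) a ha]
    exact h.eval₃ (hD.subset hb) (hD.subset hb) ha (by simpa using hb)
  have compl₂ : ({2} : Set (Fin 3))ᶜ ⊆ {0, 1} := fun i hi => by fin_cases i <;> simp_all
  have compl₀₁ : ({0, 1} : Set (Fin 3))ᶜ ⊆ {2} := fun i hi => by fin_cases i <;> simp_all
  have mB : Absorbs B (center B C R) m {2} :=
    (hR.absorbs_or_absorbs hid m {2}).resolve_right fun h => not₂ cC hmC (h.mono compl₂)
  have mC : Absorbs C (center C B fun y x => R x y) m {2} :=
    ((hR.absorbs_or_absorbs hid m {0, 1}).resolve_left (not₂ cB hmB)).mono compl₀₁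
  refine ⟨cC, fun t I => ⟨fun h' h => ?_, fun h => ?_⟩, hC, mC⟩
  · exact cC.not_absorbs_and_compl hSL
      (fun x hx y hy => ⟨hC x hx y hy, hmC x (cC.subset hx) y (cC.subset hy)⟩) mC t I ⟨h, h'⟩
  · by_contra h'
    refine cB.not_absorbs_and_compl hSL
      (fun x hx y hy => ⟨hB x hx y hy, hmB x (cB.subset hx) y (cB.subset hy)⟩) mB t I
      ⟨(hR.absorbs_or_absorbs hid t I).resolve_right h',
        (hR.absorbs_or_absorbs hid t Iᶜ).resolve_right ?_⟩
    rwa [compl_compl]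

end Linked

/-- The size of the subalgebra generated by a pair. -/
noncomputable def pairSize (A : UAlgebra σ) (a b : A.carrier) : ℕ := (A.ClosureSet {a, b}).ncard

/-- Some term operation satisfies one Mal'tsev identity at `(a, b)` and the other at `(c, d)`. -/
def LocalMaltsev (A : UAlgebra σ) (a b c d : A.carrier) : Prop :=
  ∃ t : Term σ 3, t.eval A ![a, b, b] = a ∧ t.eval A ![c, c, d] = d

variable [Finite A.carrier]

theorem pairSize_le {S : Set A.carrier} (hS : A.IsClosed S) {x y : A.carrier} (hx : x ∈ S)
    (hy : y ∈ S) : A.pairSize x y ≤ S.ncard :=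
  Set.ncard_le_ncard (closureSet_pair_subset hS hx hy)

theorem IsCenter.pairSize_lt {C W : Set A.carrier} (h : IsCenter A C W) {x y : A.carrier}
    (hx : x ∈ W) (hy : y ∈ W) : A.pairSize x y < C.ncard := by
  refine (pairSize_le h.closed_center hx hy).trans_lt (Set.ncard_lt_ncard ?_)
  obtain ⟨d, hd, hdW⟩ := h.exists_notMem
  exact ⟨h.subset, fun hsub => hdW (hsub hd)⟩

/-- The relation generated by `(a, c)`, `(b, c)` and `(b, d)` when the Mal'tsev identities fail
at `(a, b)` and `(c, d)`, but hold for smaller pairs. -/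
theorem isLinked_of_not_localMaltsev (hid : A.Idempotent) {a b c d : A.carrier}
    (h : ¬ LocalMaltsev A a b c d)
    (hmin : ∀ a' b' c' d', a' ∈ A.ClosureSet {a, b} → b' ∈ A.ClosureSet {a, b} →
      c' ∈ A.ClosureSet {c, d} → d' ∈ A.ClosureSet {c, d} →
      A.pairSize a' b' + A.pairSize c' d' < A.pairSize a b + A.pairSize c d →
      LocalMaltsev A a' b' c' d') :
    IsLinked A (A.ClosureSet {a, b}) (A.ClosureSet {c, d})
      fun x y => ∃ t : Term σ 3, t.eval A ![a, b, b] = x ∧ t.eval A ![c, c, d] = y := by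
  set R : A.carrier → A.carrier → Prop :=
    fun x y => ∃ t : Term σ 3, t.eval A ![a, b, b] = x ∧ t.eval A ![c, c, d] = y with hRdef
  have cB := A.closureSet_isClosed {a, b}
  have cC := A.closureSet_isClosed {c, d}
  have hmem : ∀ {x y}, R x y → x ∈ A.ClosureSet {a, b} ∧ y ∈ A.ClosureSet {c, d} := by
    rintro x y ⟨t, rfl, rfl⟩
    exact ⟨cB.eval₃_mem t (left_mem_closureSet a b) (right_mem_closureSet a b)
      (right_mem_closureSet a b), cC.eval₃_mem t (left_mem_closureSet c d)
      (left_mem_closureSet c d) (right_mem_closureSet c d)⟩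
  refine ⟨cB, cC, hmem, ?_, ?_, ?_, ?_, ?_⟩
  · intro f x y hxy
    choose t ht ht' using hxy
    exact ⟨.app f t, by simp only [Term.eval, ht], by simp only [Term.eval, ht']⟩
  · refine ⟨b, right_mem_closureSet a b, fun y hy => ?_⟩
    obtain ⟨p, rfl⟩ := mem_closureSet_pair_iff.1 hy
    exact ⟨p.subst ![.var 1, .var 2], by simp [eval_subst₂, eval_var, hid.eval₂],
      by simp [eval_subst₂, eval_var]⟩
  · refine ⟨c, left_mem_closureSet c d, fun x hx => ?_⟩
    obtain ⟨p, rfl⟩ := mem_closureSet_pair_iff.1 hx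
    exact ⟨p.subst ![.var 0, .var 1], by simp [eval_subst₂, eval_var],
      by simp [eval_subst₂, eval_var, hid.eval₂]⟩
  · exact ⟨a, left_mem_closureSet a b, d, right_mem_closureSet c d, h⟩
  · rintro x x' y y' h₁ h₂ h₃ hne
    have hx := (hmem h₁).1
    have hx' := (hmem h₂).1
    have hy := (hmem h₁).2
    have hy' := (hmem h₃).2
    obtain ⟨s, hs, hs'⟩ := hmin x x' y y' hx hx' hy hy' <| by
      rcases hne with hne | hne
      · exact add_lt_add_of_lt_of_le (Set.ncard_lt_ncard
          ((closureSet_pair_subset cB hx hx').ssubset_of_ne hne)) (pairSize_le cC hy hy')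
      · exact add_lt_add_of_le_of_lt (pairSize_le cB hx hx') (Set.ncard_lt_ncard
          ((closureSet_pair_subset cC hy hy').ssubset_of_ne hne))
    obtain ⟨t₁, rfl, h₁'⟩ := h₁
    obtain ⟨t₂, rfl, rfl⟩ := h₂
    obtain ⟨t₃, h₃', rfl⟩ := h₃
    exact ⟨s.subst ![t₁, t₂, t₃], by rw [eval_subst₃, h₃', hs],
      by rw [eval_subst₃, h₁', hs']⟩

theorem localMaltsev (hid : A.Idempotent) (h1 : A.OmitsType1)
    (hedge : ∀ a b : A.carrier, A.IsEdge a b → A.IsAffEdge a b) (a b c d : A.carrier) :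
    LocalMaltsev A a b c d := by
  classical
  have hSL := noSemilattice_of_isEdge_imp_isAffEdge hid hedge
  by_contra hfail
  have hex : ∃ n, ∃ a b c d, A.pairSize a b ≤ n ∧ A.pairSize c d ≤ n ∧
      ¬ LocalMaltsev A a b c d :=
    ⟨_, a, b, c, d, le_max_left _ _, le_max_right _ _, hfail⟩
  clear hfail a b c d
  obtain ⟨n, hn, hlt⟩ : ∃ n, (∃ a b c d, A.pairSize a b ≤ n ∧ A.pairSize c d ≤ n ∧
      ¬ LocalMaltsev A a b c d) ∧ ∀ a b c d, A.pairSize a b < n → A.pairSize c d < n →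
      LocalMaltsev A a b c d := by
    refine ⟨Nat.find hex, Nat.find_spec hex, fun a b c d hab hcd => ?_⟩
    by_contra hne
    exact Nat.find_min hex (max_lt hab hcd)
      ⟨a, b, c, d, le_max_left _ _, le_max_right _ _, hne⟩
  clear hex
  have hex : ∃ s, ∃ a b c d, A.pairSize a b ≤ n ∧ A.pairSize c d ≤ n ∧
      ¬ LocalMaltsev A a b c d ∧ A.pairSize a b + A.pairSize c d = s := by
    obtain ⟨a, b, c, d, hab, hcd, hne⟩ := hn
    exact ⟨_, a, b, c, d, hab, hcd, hne, rfl⟩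
  obtain ⟨a, b, c, d, hab, hcd, hne, hs⟩ := Nat.find_spec hex
  have hmin : ∀ a' b' c' d', A.pairSize a' b' ≤ n → A.pairSize c' d' ≤ n →
      A.pairSize a' b' + A.pairSize c' d' < A.pairSize a b + A.pairSize c d →
      LocalMaltsev A a' b' c' d' := by
    intro a' b' c' d' h₁ h₂ h₃
    by_contra hne'
    exact Nat.find_min hex (hs ▸ h₃) ⟨a', b', c', d', h₁, h₂, hne', rfl⟩
  clear hs hex hn
  have cB := A.closureSet_isClosed {a, b}
  have cC := A.closureSet_isClosed {c, d}
  have hR := isLinked_of_not_localMaltsev hid hne fun a' b' c' d' ha' hb' hc' hd' =>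
    hmin a' b' c' d' ((pairSize_le cB ha' hb').trans hab) ((pairSize_le cC hc' hd').trans hcd)
  have zB := hR.isCenter hid
  have zC := hR.flip.isCenter hid
  have closedL : ∀ a b (t : Term σ 3), A.pairSize a (t.eval A ![a, b, b]) ≤ A.pairSize a b :=
    fun a b t => pairSize_le (A.closureSet_isClosed _) (left_mem_closureSet a b)
      ((A.closureSet_isClosed _).eval₃_mem t (left_mem_closureSet a b) (right_mem_closureSet a b)
        (right_mem_closureSet a b))
  have closedJ : ∀ c d (t : Term σ 3), A.pairSize (t.eval A ![c, c, d]) d ≤ A.pairSize c d :=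
    fun c d t => pairSize_le (A.closureSet_isClosed _)
      ((A.closureSet_isClosed _).eval₃_mem t (left_mem_closureSet c d) (left_mem_closureSet c d)
        (right_mem_closureSet c d)) (right_mem_closureSet c d)
  have ltB : ∀ x ∈ IsLinked.center _ _ _, ∀ y ∈ IsLinked.center _ _ _, A.pairSize x y < n :=
    fun x hx y hy => (zB.pairSize_lt hx hy).trans_le hab
  have ltC : ∀ x ∈ IsLinked.center _ _ _, ∀ y ∈ IsLinked.center _ _ _, A.pairSize x y < n :=
    fun x hx y hy => (zC.pairSize_lt hx hy).trans_le hcd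
  by_cases hsmall : A.pairSize a b < n ∨ A.pairSize c d < n
  · obtain ⟨m, hmL, hmJ⟩ := exists_term_forall_pairs hid
      (L := fun a b => A.pairSize a b < n) (J := fun a b => A.pairSize a b < n)
      (fun a b h t => (closedL a b t).trans_lt h) (fun c d h t => (closedJ c d t).trans_lt h) hlt
    rcases hsmall with h | h
    · exact hR.false_of_isMaltsev_left hid hSL m
        (fun x hx y hy => have := (pairSize_le cB hx hy).trans_lt h
          ⟨hmL x y this, hmJ x y this⟩)
        fun x hx y hy => ⟨hmL x y (ltC x hx y hy), hmJ x y (ltC x hx y hy)⟩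
    · exact hR.flip.false_of_isMaltsev_left hid hSL m
        (fun x hx y hy => have := (pairSize_le cC hx hy).trans_lt h
          ⟨hmL x y this, hmJ x y this⟩)
        fun x hx y hy => ⟨hmL x y (ltB x hx y hy), hmJ x y (ltB x hx y hy)⟩
  · obtain ⟨m, hmL, hmJ⟩ := exists_term_forall_pairs hid
      (L := fun a b => A.pairSize a b < n) (J := fun a b => A.pairSize a b ≤ n)
      (fun a b h t => (closedL a b t).trans_lt h) (fun c d h t => (closedJ c d t).trans h)
      (fun a' b' c' d' h h' => hmin a' b' c' d' h.le h' (by omega))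
    exact (hR.isSelfDualCenter hid hSL
      (fun x hx y hy => hmJ x y ((pairSize_le cB hx hy).trans hab))
      (fun x hx y hy => hmJ x y ((pairSize_le cC hx hy).trans hcd))
      (fun x hx y hy => hmL x y (ltB x hx y hy))
      (fun x hx y hy => hmL x y (ltC x hx y hy))).false_of_omitsType1 hid h1 hSL hedge

end Maltsev

end UAlgebra

/-- a finite idempotent algebra omitting type 1 all of whose
edges are affine is Mal'tsev. -/
theorem stmt_15 (σ : Signature) (A : UAlgebra σ)
    (hfin : Finite A.carrier) (hne : Nonempty A.carrier) (hid : A.Idempotent)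
    (h1 : A.OmitsType1)
    (hedge : ∀ a b : A.carrier, A.IsEdge a b → A.IsAffEdge a b) :
    ∃ t : Term σ 3, ∀ x y : A.carrier,
      t.eval A ![x, y, y] = x ∧ t.eval A ![y, y, x] = x := by
  obtain ⟨t, hl, hr⟩ := UAlgebra.exists_term_forall_pairs hid (L := fun _ _ => True)
    (J := fun _ _ => True) (fun _ _ _ _ => trivial) (fun _ _ _ _ => trivial)
    fun a b c d _ _ => UAlgebra.localMaltsev hid h1 hedge a b c d
  exact ⟨t, fun x y => ⟨hl x y trivial, hr y x trivial⟩⟩
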